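/- For nonnegative integers r and s, let N(r, s) be the number of elements m of the monoid M that are abstract skeleta (every word in Σ* representing m starts with c_1 or t_1, and no representing word contains a factor c_i c_i) and whose representatives contain exactly r letters from {c_i : i ≥ 1} and exactly s letters from {t_i : i ≥ 1} (these counts are well defined since the defining relations of M preserve them). Then each N(r, s) is finite, and the formal power series S(c, t) = Σ_{r,s ≥ 0} N(r, s) c^r t^s in ℚ[[c, t]] satisfies S = 1 + c·(1 + c)^{-1}·S² + t·S³, where (1 + c)^{-1} is the multiplicative inverse of 1 + c in ℚ[[c, t]]. -/

import Mathlib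

/-- The alphabet `Σ = {c_i : i ≥ 1} ∪ {t_i : i ≥ 1}` (where `t_i` stands for
`t_{i,i+1}`). -/
inductive Letter : Type
  | c (i : ℕ+)
  | t (i : ℕ+)
  deriving DecidableEq

/-- The defining relations of the trace monoid `M`:
`c_i c_j = c_j c_i` for `|i - j| ≥ 2`; `c_i t_j = t_j c_i` for `i ≤ j - 2` or
`i ≥ j + 3`; `t_i t_j = t_j t_i` for `|i - j| ≥ 3`. -/
def SkelRel (u v : FreeMonoid Letter) : Prop :=
  (∃ i j : ℕ+, (i + 2 ≤ j ∨ j + 2 ≤ i) ∧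
    u = FreeMonoid.of (.c i) * FreeMonoid.of (.c j) ∧
    v = FreeMonoid.of (.c j) * FreeMonoid.of (.c i)) ∨
  (∃ i j : ℕ+, (i + 2 ≤ j ∨ j + 3 ≤ i) ∧
    u = FreeMonoid.of (.c i) * FreeMonoid.of (.t j) ∧
    v = FreeMonoid.of (.t j) * FreeMonoid.of (.c i)) ∨
  (∃ i j : ℕ+, (i + 3 ≤ j ∨ j + 3 ≤ i) ∧
    u = FreeMonoid.of (.t i) * FreeMonoid.of (.t j) ∧
    v = FreeMonoid.of (.t j) * FreeMonoid.of (.t i))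

/-- The congruence on the free monoid `Σ*` generated by the partial commutation
relations. -/
def SkelCon : Con (FreeMonoid Letter) := conGen SkelRel

/-- The free partially commuting (trace) monoid `M`. -/
abbrev SkelMonoid : Type := SkelCon.Quotient

/-- The image in `M` of a word in `Σ*`. -/
def toSkel (w : List Letter) : SkelMonoid := SkelCon.mk' (FreeMonoid.ofList w)

/-- An abstract skeleton: every representing word starts (if nonempty) with `c_1` or
`t_1`, and no representing word contains a factor `c_i c_i`. -/
def IsAbstractSkeleton (m : SkelMonoid) : Prop :=
  (∀ w : List Letter, toSkel w = m → ∀ l : Letter, ∀ w' : List Letter,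
      w = l :: w' → (l = Letter.c 1 ∨ l = Letter.t 1)) ∧
  (∀ w : List Letter, toSkel w = m → ∀ (i : ℕ+) (u v : List Letter),
      w ≠ u ++ [Letter.c i, Letter.c i] ++ v)

/-- The number of letters of the form `c_i` in a word. -/
def countC (w : List Letter) : ℕ :=
  w.countP (fun l => match l with | .c _ => true | .t _ => false)

/-- The number of letters of the form `t_i` in a word. -/
def countT (w : List Letter) : ℕ :=
  w.countP (fun l => match l with | .c _ => false | .t _ => true)

/-- The set of abstract skeleta with exactly `r` clone-set letters and `s` tangle
letters (these counts are preserved by the defining relations of `M`, hence well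
defined on `M`). -/
def SkelSet (r s : ℕ) : Set SkelMonoid :=
  {m | IsAbstractSkeleton m ∧ ∃ w : List Letter, toSkel w = m ∧ countC w = r ∧ countT w = s}

/-- Trees encoding the heaps all of whose minimal pieces sit at one fixed leftmost position:
`clone a b` encodes `c_i · a · b` with `a` based at `i + 1` and `b` at `i`, and `tangle a b d`
encodes `t_i · a · b · d` with `a`, `b`, `d` based at `i + 2`, `i + 1`, `i`. -/
inductive SkelTree : Type
  | nil
  | clone (a b : SkelTree)
  | tangle (a b d : SkelTree)

namespace SkelTree

/-- The root of the tree is a clone node. -/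
def IsClone (T : SkelTree) : Prop := ∃ a b, T = clone a b

/-- No clone node sits directly on top of another one. -/
def Strict : SkelTree → Prop
  | nil => True
  | clone a b => a.Strict ∧ b.Strict ∧ ¬(a = nil ∧ b.IsClone)
  | tangle a b d => a.Strict ∧ b.Strict ∧ d.Strict

/-- The numbers of clone and tangle nodes. -/
noncomputable def weight : SkelTree → (Fin 2 →₀ ℕ)
  | nil => 0
  | clone a b => (a.weight + b.weight) + Finsupp.single 0 1
  | tangle a b d => (a.weight + (b.weight + d.weight)) + Finsupp.single 1 1

/-- The element of `M` encoded by a tree based at position `n + 1`. -/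
def build : ℕ → SkelTree → SkelMonoid
  | _, nil => 1
  | n, clone a b => toSkel [.c n.succPNat] * (build (n + 1) a * build n b)
  | n, tangle a b d =>
      toSkel [.t n.succPNat] * (build (n + 2) a * (build (n + 1) b * build n d))

end SkelTree

open SkelTree

theorem toSkel_append (u v : List Letter) : toSkel (u ++ v) = toSkel u * toSkel v := rfl

theorem toSkel_cons (l : Letter) (v : List Letter) : toSkel (l :: v) = toSkel [l] * toSkel v := rfl

theorem toSkel_nil : toSkel [] = 1 := rfl

theorem toSkel_surjective (m : SkelMonoid) : ∃ w, toSkel w = m := by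
  obtain ⟨w, rfl⟩ := Con.mk'_surjective m
  exact ⟨w.toList, rfl⟩

/-- Stacking the piece `c_{p+1}` below a family of trees. -/
def stepClone (p : ℕ) (f : ℕ → SkelTree) : ℕ → SkelTree := fun k =>
  if k = p then clone (f (p + 1)) (f p) else if k = p + 1 then nil else f k

/-- Stacking the piece `t_{p+1}` below a family of trees. -/
def stepTangle (p : ℕ) (f : ℕ → SkelTree) : ℕ → SkelTree := fun k =>
  if k = p then tangle (f (p + 2)) (f (p + 1)) (f p)
  else if k = p + 1 ∨ k = p + 2 then nil else f k

/-- Stacking a piece below a family of trees. -/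
def letterStep : Letter → Function.End (ℕ → SkelTree)
  | .c i => stepClone i.natPred
  | .t i => stepTangle i.natPred

theorem skelCon_le_ker {P : Type*} [Monoid P] (g : Letter → P)
    (hcc : ∀ i j : ℕ+, i.natPred + 2 ≤ j.natPred → Commute (g (.c i)) (g (.c j)))
    (hct : ∀ i j : ℕ+, i.natPred + 2 ≤ j.natPred ∨ j.natPred + 3 ≤ i.natPred →
      Commute (g (.c i)) (g (.t j)))
    (htt : ∀ i j : ℕ+, i.natPred + 3 ≤ j.natPred → Commute (g (.t i)) (g (.t j))) :
    SkelCon ≤ Con.ker (FreeMonoid.lift g) := by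
  have key : ∀ (i j : ℕ+) (n : ℕ+), i + n ≤ j → i.natPred + n ≤ j.natPred := by
    intro i j n h
    have h1 := i.natPred_add_one
    have h2 := j.natPred_add_one
    have h3 : (i : ℕ) + n ≤ j := by exact_mod_cast h
    omega
  refine Con.conGen_le.2 ?_
  rintro _ _ (⟨i, j, h, rfl, rfl⟩ | ⟨i, j, h, rfl, rfl⟩ | ⟨i, j, h, rfl, rfl⟩) <;>
    simp only [Con.ker_rel, map_mul, FreeMonoid.lift_eval_of]
  · rcases h with h | h
    · exact hcc i j (key _ _ 2 h)
    · exact (hcc j i (key _ _ 2 h)).symm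
  · exact hct i j (h.imp (key _ _ 2) (key _ _ 3))
  · rcases h with h | h
    · exact htt i j (key _ _ 3 h)
    · exact (htt j i (key _ _ 3 h)).symm

theorem stepClone_comm {p q : ℕ} (h : p + 2 ≤ q) (f : ℕ → SkelTree) :
    stepClone p (stepClone q f) = stepClone q (stepClone p f) := by
  funext k
  simp only [stepClone]
  grind

theorem stepClone_stepTangle_comm {p q : ℕ} (h : p + 2 ≤ q ∨ q + 3 ≤ p) (f : ℕ → SkelTree) :
    stepClone p (stepTangle q f) = stepTangle q (stepClone p f) := by
  funext k
  simp only [stepClone, stepTangle]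
  grind

theorem stepTangle_comm {p q : ℕ} (h : p + 3 ≤ q) (f : ℕ → SkelTree) :
    stepTangle p (stepTangle q f) = stepTangle q (stepTangle p f) := by
  funext k
  simp only [stepTangle]
  grind

/-- The action of `M` on families of trees. -/
def skelAct : SkelMonoid →* Function.End (ℕ → SkelTree) :=
  SkelCon.lift (FreeMonoid.lift letterStep) <| skelCon_le_ker _
    (fun _ _ h => funext fun f => stepClone_comm h f)
    (fun _ _ h => funext fun f => stepClone_stepTangle_comm h f)
    (fun _ _ h => funext fun f => stepTangle_comm h f)

theorem skelAct_letter (l : Letter) : skelAct (toSkel [l]) = letterStep l := by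
  change FreeMonoid.lift letterStep (FreeMonoid.of l) = _
  simp

theorem skelAct_mul (m m' : SkelMonoid) (f : ℕ → SkelTree) :
    skelAct (m * m') f = skelAct m (skelAct m' f) := by
  rw [map_mul]; rfl

theorem skelAct_one (f : ℕ → SkelTree) : skelAct 1 f = f := by
  rw [map_one]; rfl

/-- The weight of a single letter. -/
noncomputable def letterWeight : Letter → Multiplicative (Fin 2 →₀ ℕ)
  | .c _ => Multiplicative.ofAdd (Finsupp.single 0 1)
  | .t _ => Multiplicative.ofAdd (Finsupp.single 1 1)

/-- The numbers of letters of each kind in an element of `M`. -/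
noncomputable def skelWeight : SkelMonoid →* Multiplicative (Fin 2 →₀ ℕ) :=
  SkelCon.lift (FreeMonoid.lift letterWeight) <| skelCon_le_ker _
    (fun _ _ _ => Commute.all _ _) (fun _ _ _ => Commute.all _ _) (fun _ _ _ => Commute.all _ _)

theorem skelWeight_c (i : ℕ+) :
    skelWeight (toSkel [.c i]) = Multiplicative.ofAdd (Finsupp.single 0 1) := by
  change FreeMonoid.lift letterWeight (FreeMonoid.of (Letter.c i)) = _
  simp [letterWeight]

theorem skelWeight_t (i : ℕ+) :
    skelWeight (toSkel [.t i]) = Multiplicative.ofAdd (Finsupp.single 1 1) := by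
  change FreeMonoid.lift letterWeight (FreeMonoid.of (Letter.t i)) = _
  simp [letterWeight]

theorem skelWeight_toSkel (w : List Letter) : skelWeight (toSkel w) =
    Multiplicative.ofAdd (Finsupp.single 0 (countC w) + Finsupp.single 1 (countT w)) := by
  induction w with
  | nil => simp [toSkel_nil, countC, countT]
  | cons l w ih =>
    rw [toSkel_cons, map_mul, ih]
    cases l with
    | c i =>
      rw [skelWeight_c, ← ofAdd_add]
      congr 1
      simp only [countC, countT, List.countP_cons, Finsupp.single_add]
      simp
      abel
    | t i =>
      rw [skelWeight_t, ← ofAdd_add]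
      congr 1
      simp only [countC, countT, List.countP_cons, Finsupp.single_add]
      simp
      abel

theorem skelWeight_build (n : ℕ) (T : SkelTree) :
    skelWeight (build n T) = Multiplicative.ofAdd T.weight := by
  induction T generalizing n with
  | nil => simp [build, weight]
  | clone a b iha ihb =>
    simp only [build, weight, map_mul, iha, ihb, skelWeight_c, ← ofAdd_add]
    rw [add_comm]
  | tangle a b d iha ihb ihd =>
    simp only [build, weight, map_mul, iha, ihb, ihd, skelWeight_t, ← ofAdd_add]
    rw [add_comm]

theorem skelAct_build (n : ℕ) (T : SkelTree) (f : ℕ → SkelTree) (hf : ∀ k, n ≤ k → f k = nil) :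
    skelAct (build n T) f = Function.update f n T := by
  induction T generalizing n f with
  | nil => rw [build, skelAct_one, ← hf n le_rfl, Function.update_eq_self]
  | clone a b iha ihb =>
    rw [build, skelAct_mul, skelAct_mul, ihb n f hf, iha, skelAct_letter]
    · funext k
      simp only [letterStep, stepClone, Nat.natPred_succPNat, Function.update_apply]
      grind
    · intro k hk
      rw [Function.update_of_ne (by omega)]
      exact hf k (by omega)
  | tangle a b d iha ihb ihd =>
    rw [build, skelAct_mul, skelAct_mul, skelAct_mul, ihd n f hf, ihb, iha, skelAct_letter]
    · funext k
      simp only [letterStep, stepTangle, Nat.natPred_succPNat, Function.update_apply]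
      grind
    · intro k hk
      rw [Function.update_of_ne (by omega), Function.update_of_ne (by omega)]
      exact hf k (by omega)
    · intro k hk
      rw [Function.update_of_ne (by omega)]
      exact hf k (by omega)

theorem skelAct_build_nil (n : ℕ) (T : SkelTree) :
    skelAct (build n T) (fun _ => nil) = Function.update (fun _ => nil) n T :=
  skelAct_build n T _ fun _ _ => rfl

theorem build_injective (n : ℕ) : Function.Injective (build n) := by
  intro T T' h
  have h1 := congrFun (skelAct_build_nil n T) n
  rw [h, skelAct_build_nil] at h1
  simpa using h1.symm

theorem toSkel_comm_cc {p q : ℕ} (h : p + 2 ≤ q) :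
    Commute (toSkel [.c p.succPNat]) (toSkel [.c q.succPNat]) :=
  (Con.eq _).2 <| ConGen.Rel.of _ _ <| Or.inl
    ⟨_, _, Or.inl (by rw [← PNat.coe_le_coe]; simp; omega), rfl, rfl⟩

theorem toSkel_comm_ct {p q : ℕ} (h : p + 2 ≤ q ∨ q + 3 ≤ p) :
    Commute (toSkel [.c p.succPNat]) (toSkel [.t q.succPNat]) :=
  (Con.eq _).2 <| ConGen.Rel.of _ _ <| Or.inr <| Or.inl
    ⟨_, _, by rw [← PNat.coe_le_coe, ← PNat.coe_le_coe]; simp; omega, rfl, rfl⟩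

theorem toSkel_comm_tt {p q : ℕ} (h : p + 3 ≤ q) :
    Commute (toSkel [.t p.succPNat]) (toSkel [.t q.succPNat]) :=
  (Con.eq _).2 <| ConGen.Rel.of _ _ <| Or.inr <| Or.inr
    ⟨_, _, Or.inl (by rw [← PNat.coe_le_coe]; simp; omega), rfl, rfl⟩

theorem commute_build {m : SkelMonoid} {n₀ : ℕ}
    (hc : ∀ n, n₀ ≤ n → Commute m (toSkel [.c n.succPNat]))
    (ht : ∀ n, n₀ ≤ n → Commute m (toSkel [.t n.succPNat])) (T : SkelTree) :
    ∀ n, n₀ ≤ n → Commute m (build n T) := by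
  induction T with
  | nil => exact fun n _ => Commute.one_right m
  | clone a b iha ihb =>
    exact fun n hn => (hc n hn).mul_right ((iha _ (by omega)).mul_right (ihb _ hn))
  | tangle a b d iha ihb ihd =>
    exact fun n hn => (ht n hn).mul_right
      ((iha _ (by omega)).mul_right ((ihb _ (by omega)).mul_right (ihd _ hn)))

/-- The product `⋯ f_2 · f_1 · f_0` of the first `N` members of a family of trees. -/
def buildFamily (f : ℕ → SkelTree) : ℕ → SkelMonoid
  | 0 => 1
  | N + 1 => build N (f N) * buildFamily f N

theorem buildFamily_congr {f g : ℕ → SkelTree} {N : ℕ} (h : ∀ k < N, f k = g k) :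
    buildFamily f N = buildFamily g N := by
  induction N with
  | zero => rfl
  | succ N ih => rw [buildFamily, buildFamily, h N (by omega), ih fun k hk => h k (by omega)]

theorem mul_buildFamily_clone (p : ℕ) (f : ℕ → SkelTree) {N : ℕ} (hN : p + 2 ≤ N) :
    toSkel [.c p.succPNat] * buildFamily f N = buildFamily (stepClone p f) N := by
  induction N, hN using Nat.le_induction with
  | base =>
    have h : buildFamily (stepClone p f) p = buildFamily f p :=
      buildFamily_congr fun k hk => by simp only [stepClone]; grind
    simp only [buildFamily, h]
    simp [stepClone, build, mul_assoc]
  | succ N hN ih =>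
    have h : stepClone p f N = f N := by simp only [stepClone]; grind
    rw [buildFamily, buildFamily, ← ih, h, ← mul_assoc, ← mul_assoc]
    congr 1
    exact commute_build (fun n hn => toSkel_comm_cc hn) (fun n hn => toSkel_comm_ct (Or.inl hn))
      _ _ hN

theorem mul_buildFamily_tangle (p : ℕ) (f : ℕ → SkelTree) {N : ℕ} (hN : p + 3 ≤ N) :
    toSkel [.t p.succPNat] * buildFamily f N = buildFamily (stepTangle p f) N := by
  induction N, hN using Nat.le_induction with
  | base =>
    have h : buildFamily (stepTangle p f) p = buildFamily f p :=
      buildFamily_congr fun k hk => by simp only [stepTangle]; grind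
    simp only [buildFamily, h]
    simp [stepTangle, build, mul_assoc]
  | succ N hN ih =>
    have h : stepTangle p f N = f N := by simp only [stepTangle]; grind
    rw [buildFamily, buildFamily, ← ih, h, ← mul_assoc, ← mul_assoc]
    congr 1
    exact commute_build (fun n hn => (toSkel_comm_ct (Or.inr hn)).symm)
      (fun n hn => toSkel_comm_tt hn) _ _ hN

theorem buildFamily_nil (N : ℕ) : buildFamily (fun _ => nil) N = 1 := by
  induction N with
  | zero => rfl
  | succ N ih => simp [buildFamily, build, ih]

theorem exists_buildFamily_eq (w : List Letter) : ∃ N₀, ∀ N, N₀ ≤ N →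
    buildFamily (skelAct (toSkel w) fun _ => nil) N = toSkel w := by
  induction w with
  | nil => exact ⟨0, fun N _ => by rw [toSkel_nil, skelAct_one, buildFamily_nil]⟩
  | cons l w ih =>
    obtain ⟨N₀, h⟩ := ih
    cases l with
    | c i =>
      refine ⟨N₀ + i.natPred + 2, fun N hN => ?_⟩
      rw [toSkel_cons, skelAct_mul, skelAct_letter, letterStep,
        ← mul_buildFamily_clone _ _ (by omega), h N (by omega), PNat.succPNat_natPred]
    | t i =>
      refine ⟨N₀ + i.natPred + 3, fun N hN => ?_⟩
      rw [toSkel_cons, skelAct_mul, skelAct_letter, letterStep,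
        ← mul_buildFamily_tangle _ _ (by omega), h N (by omega), PNat.succPNat_natPred]

/-- Some word representing the element has a factor `c_i c_i`. -/
def HasSquare (m : SkelMonoid) : Prop :=
  ∃ (i : ℕ+) (u v : List Letter), toSkel (u ++ [.c i, .c i] ++ v) = m

theorem HasSquare.mul_left {m : SkelMonoid} (h : HasSquare m) (m' : SkelMonoid) :
    HasSquare (m' * m) := by
  obtain ⟨i, u, v, rfl⟩ := h
  obtain ⟨w, rfl⟩ := toSkel_surjective m'
  exact ⟨i, w ++ u, v, by simp only [toSkel_append, mul_assoc]⟩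

theorem HasSquare.mul_right {m : SkelMonoid} (h : HasSquare m) (m' : SkelMonoid) :
    HasSquare (m * m') := by
  obtain ⟨i, u, v, rfl⟩ := h
  obtain ⟨w, rfl⟩ := toSkel_surjective m'
  exact ⟨i, u, v ++ w, by simp only [toSkel_append, mul_assoc]⟩

theorem strict_of_not_hasSquare (T : SkelTree) (n : ℕ) (h : ¬HasSquare (build n T)) :
    T.Strict := by
  induction T generalizing n with
  | nil => trivial
  | clone a b iha ihb =>
    refine ⟨iha _ fun ha => h ((ha.mul_right _).mul_left _),
      ihb _ fun hb => h ((hb.mul_left _).mul_left _), ?_⟩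
    rintro ⟨rfl, a, b, rfl⟩
    obtain ⟨w, hw⟩ := toSkel_surjective (build (n + 1) a * build n b)
    refine h ⟨n.succPNat, [], w, ?_⟩
    rw [build, build, build, ← hw, one_mul]
    rfl
  | tangle a b d iha ihb ihd =>
    exact ⟨iha _ fun ha => h ((ha.mul_right _).mul_left _),
      ihb _ fun hb => h (((hb.mul_right _).mul_left _).mul_left _),
      ihd _ fun hd => h (((hd.mul_left _).mul_left _).mul_left _)⟩

theorem strict_of_letterStep (l : Letter) (f : ℕ → SkelTree)
    (h : ∀ k, (letterStep l f k).Strict) (k : ℕ) : (f k).Strict := by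
  cases l with
  | c i =>
    have h1 := h i.natPred
    have h2 := h k
    simp only [letterStep, stepClone, if_true, Strict] at h1 h2
    grind
  | t i =>
    have h1 := h i.natPred
    have h2 := h k
    simp only [letterStep, stepTangle, if_true, Strict] at h1 h2
    grind

theorem strict_of_skelAct (w : List Letter) (f : ℕ → SkelTree)
    (h : ∀ k, (skelAct (toSkel w) f k).Strict) : ∀ k, (f k).Strict := by
  induction w with
  | nil => simpa only [toSkel_nil, skelAct_one] using h
  | cons l w ih =>
    rw [toSkel_cons, skelAct_mul, skelAct_letter] at h
    exact ih (strict_of_letterStep l _ h)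

theorem not_hasSquare_of_strict {m : SkelMonoid}
    (h : ∀ k, (skelAct m (fun _ => nil) k).Strict) : ¬HasSquare m := by
  rintro ⟨i, u, v, rfl⟩
  rw [List.append_assoc, toSkel_append, skelAct_mul] at h
  have h1 := strict_of_skelAct u _ h i.natPred
  rw [List.cons_append, List.cons_append, List.nil_append, toSkel_cons _ (.c i :: v),
    toSkel_cons _ v, skelAct_mul, skelAct_mul, skelAct_letter] at h1
  simp only [letterStep, stepClone, if_true, Strict] at h1
  exact h1.2.2 ⟨if_neg (by omega), _, _, rfl⟩

theorem letterStep_ne_nil (l : Letter) (f : ℕ → SkelTree) :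
    ∃ i : ℕ+, (l = .c i ∨ l = .t i) ∧ letterStep l f i.natPred ≠ nil := by
  cases l with
  | c i => exact ⟨i, Or.inl rfl, by simp [letterStep, stepClone]⟩
  | t i => exact ⟨i, Or.inr rfl, by simp [letterStep, stepTangle]⟩

theorem isAbstractSkeleton_build {T : SkelTree} (hT : T.Strict) :
    IsAbstractSkeleton (build 0 T) := by
  constructor
  · rintro _ hw l w rfl
    have h := skelAct_build_nil 0 T
    rw [← hw, toSkel_cons, skelAct_mul, skelAct_letter] at h
    obtain ⟨i, hl, hi⟩ := letterStep_ne_nil l (skelAct (toSkel w) fun _ => nil)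
    have h0 : i.natPred = 0 := by
      by_contra h0
      rw [h, Function.update_of_ne h0] at hi
      exact hi rfl
    obtain rfl : i = 1 := by rw [← PNat.succPNat_natPred i, h0]; rfl
    exact hl
  · rintro w hw i u v rfl
    refine not_hasSquare_of_strict (fun k => ?_) ⟨i, u, v, hw⟩
    rw [skelAct_build_nil, Function.update_apply]
    split_ifs
    exacts [hT, trivial]

theorem exists_cons_eq_build (n : ℕ) {T : SkelTree} (hT : T ≠ nil) (m : SkelMonoid) :
    ∃ l w, (l = .c n.succPNat ∨ l = .t n.succPNat) ∧ toSkel (l :: w) = build n T * m := by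
  cases T with
  | nil => exact absurd rfl hT
  | clone a b =>
    obtain ⟨w, hw⟩ := toSkel_surjective (build (n + 1) a * build n b * m)
    exact ⟨_, w, Or.inl rfl, by rw [toSkel_cons, hw, build]; simp only [mul_assoc]⟩
  | tangle a b d =>
    obtain ⟨w, hw⟩ :=
      toSkel_surjective (build (n + 2) a * (build (n + 1) b * build n d) * m)
    exact ⟨_, w, Or.inr rfl, by rw [toSkel_cons, hw, build]; simp only [mul_assoc]⟩

theorem buildFamily_eq_build_zero (f : ℕ → SkelTree) (N : ℕ)
    (h : IsAbstractSkeleton (buildFamily f (N + 1))) :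
    buildFamily f (N + 1) = build 0 (f 0) := by
  induction N with
  | zero => simp [buildFamily]
  | succ N ih =>
    have hN : f (N + 1) = nil := by
      by_contra hN
      obtain ⟨l, w, hl, hw⟩ := exists_cons_eq_build (N + 1) hN (buildFamily f (N + 1))
      have h1 := h.1 _ hw l w rfl
      have h2 : (N + 1).succPNat ≠ 1 := fun h => by simpa using congrArg PNat.val h
      rcases hl with rfl | rfl <;> simp [h2] at h1
    rw [buildFamily, hN, build, one_mul] at h ⊢
    exact ih h

theorem isAbstractSkeleton_iff (m : SkelMonoid) :
    IsAbstractSkeleton m ↔ ∃ T : SkelTree, T.Strict ∧ build 0 T = m := by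
  constructor
  · intro hm
    obtain ⟨w, rfl⟩ := toSkel_surjective m
    obtain ⟨N, hN⟩ := exists_buildFamily_eq w
    have hN' := hN (N + 1) (by omega)
    have h := buildFamily_eq_build_zero _ N (by rwa [hN'])
    rw [hN'] at h
    refine ⟨_, strict_of_not_hasSquare _ 0 ?_, h.symm⟩
    rw [← h]
    rintro ⟨i, u, v, huv⟩
    exact hm.2 _ huv i u v rfl
  · rintro ⟨T, hT, rfl⟩
    exact isAbstractSkeleton_build hT

theorem skelSet_eq (d : Fin 2 →₀ ℕ) :
    SkelSet (d 0) (d 1) = build 0 '' {T | T.Strict ∧ T.weight = d} := by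
  have hd : Finsupp.single 0 (d 0) + Finsupp.single 1 (d 1) = d := by
    ext i; fin_cases i <;> simp
  ext m
  simp only [SkelSet, Set.mem_ofPred_eq, isAbstractSkeleton_iff, Set.mem_image]
  constructor
  · rintro ⟨⟨T, hT, rfl⟩, w, hw, hc, ht⟩
    have h := skelWeight_toSkel w
    rw [hw, skelWeight_build, hc, ht, hd] at h
    exact ⟨T, ⟨hT, h⟩, rfl⟩
  · rintro ⟨T, ⟨hT, hTd⟩, rfl⟩
    obtain ⟨w, hw⟩ := toSkel_surjective (build 0 T)
    have h := skelWeight_toSkel w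
    rw [hw, skelWeight_build, hTd] at h
    have h' : d = Finsupp.single 0 (countC w) + Finsupp.single 1 (countT w) := h
    exact ⟨⟨T, hT, rfl⟩, w, hw, by rw [h']; simp, by rw [h']; simp⟩

section WeightSeries

variable {α β σ : Type*}

/-- The power series counting the elements of a set by weight. -/
noncomputable def weightSeries (w : α → (σ →₀ ℕ)) (A : Set α) : MvPowerSeries σ ℚ :=
  fun d => ({a | a ∈ A ∧ w a = d}.ncard : ℚ)

theorem coeff_weightSeries (w : α → (σ →₀ ℕ)) (A : Set α) (d : σ →₀ ℕ) :
    MvPowerSeries.coeff d (weightSeries w A) = ({a | a ∈ A ∧ w a = d}.ncard : ℚ) := rfl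

theorem weightSeries_union {w : α → (σ →₀ ℕ)} (hw : ∀ d, {a | w a = d}.Finite) {A B : Set α}
    (h : Disjoint A B) : weightSeries w (A ∪ B) = weightSeries w A + weightSeries w B := by
  ext d
  simp only [map_add, coeff_weightSeries]
  rw [← Nat.cast_add, ← Set.ncard_union_eq _ ((hw d).subset fun a ha => ha.2)
    ((hw d).subset fun a ha => ha.2)]
  · congr 2
    ext a
    simp only [Set.mem_union, Set.mem_ofPred_eq]
    tauto
  · exact h.mono (fun a ha => ha.1) fun a ha => ha.1

theorem weightSeries_image {w : α → (σ →₀ ℕ)} {w' : β → (σ →₀ ℕ)} {g : α → β}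
    (hg : Function.Injective g) (e : σ →₀ ℕ) (h : ∀ a, w' (g a) = w a + e) (A : Set α) :
    weightSeries w' (g '' A) = weightSeries w A * MvPowerSeries.monomial e 1 := by
  classical
  ext d
  rw [MvPowerSeries.coeff_mul_monomial, coeff_weightSeries, coeff_weightSeries, mul_one]
  split_ifs with hd
  · rw [← Set.ncard_image_of_injective _ hg]
    congr 2
    ext b
    constructor
    · rintro ⟨⟨a, ha, rfl⟩, hb⟩
      exact ⟨a, ⟨ha, by rw [← hb, h, add_tsub_cancel_right]⟩, rfl⟩
    · rintro ⟨a, ⟨ha, hb⟩, rfl⟩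
      exact ⟨⟨a, ha, rfl⟩, by rw [h, hb, tsub_add_cancel_of_le hd]⟩
  · rw [Nat.cast_eq_zero]
    convert Set.ncard_empty β
    rw [Set.eq_empty_iff_forall_notMem]
    rintro _ ⟨⟨a, ha, rfl⟩, hb⟩
    exact hd (by rw [← hb, h]; exact le_add_self)

theorem weightSeries_singleton {w : α → (σ →₀ ℕ)} {a : α} (ha : w a = 0) :
    weightSeries w {a} = 1 := by
  classical
  ext d
  rw [coeff_weightSeries, MvPowerSeries.coeff_one]
  split_ifs with hd
  · have : {b | b ∈ ({a} : Set α) ∧ w b = d} = {a} := by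
      ext b
      simp only [Set.mem_singleton_iff, Set.mem_ofPred_eq]
      exact ⟨fun h => h.1, fun h => ⟨h, by rw [h, ha, hd]⟩⟩
    rw [this, Set.ncard_singleton, Nat.cast_one]
  · have : {b | b ∈ ({a} : Set α) ∧ w b = d} = ∅ := by
      ext b
      simp only [Set.mem_singleton_iff, Set.mem_ofPred_eq, Set.mem_empty_iff_false, iff_false]
      rintro ⟨rfl, h⟩
      exact hd (by rw [← h, ha])
    rw [this, Set.ncard_empty, Nat.cast_zero]

/-- The weight on a product of weighted types. -/
noncomputable def prodWeight (w : α → (σ →₀ ℕ)) (w' : β → (σ →₀ ℕ)) (p : α × β) : σ →₀ ℕ :=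
  w p.1 + w' p.2

theorem setOf_prodWeight_eq [DecidableEq σ] (w : α → (σ →₀ ℕ)) (w' : β → (σ →₀ ℕ)) (A : Set α)
    (B : Set β) (d : σ →₀ ℕ) : {p | p ∈ A ×ˢ B ∧ prodWeight w w' p = d} =
      ⋃ e ∈ Finset.HasAntidiagonal.antidiagonal d,
        {a | a ∈ A ∧ w a = e.1} ×ˢ {b | b ∈ B ∧ w' b = e.2} := by
  ext ⟨a, b⟩
  simp only [Set.mem_ofPred_eq, Set.mem_prod, Set.mem_iUnion, Finset.HasAntidiagonal.mem_antidiagonal, prodWeight]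
  constructor
  · rintro ⟨⟨ha, hb⟩, h⟩
    exact ⟨(w a, w' b), h, ⟨ha, rfl⟩, hb, rfl⟩
  · rintro ⟨e, h, ⟨ha, h1⟩, hb, h2⟩
    exact ⟨⟨ha, hb⟩, by rw [h1, h2, h]⟩

theorem finite_prodWeight {w : α → (σ →₀ ℕ)} {w' : β → (σ →₀ ℕ)}
    (hw : ∀ d, {a | w a = d}.Finite) (hw' : ∀ d, {b | w' b = d}.Finite) (d : σ →₀ ℕ) :
    {p | prodWeight w w' p = d}.Finite := by
  classical
  have h := setOf_prodWeight_eq w w' Set.univ Set.univ d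
  simp only [Set.univ_prod_univ, Set.mem_univ, true_and] at h
  rw [h]
  exact Set.Finite.biUnion (Finset.finite_toSet _) fun e _ => (hw _).prod (hw' _)

theorem weightSeries_prod {w : α → (σ →₀ ℕ)} {w' : β → (σ →₀ ℕ)}
    (hw : ∀ d, {a | w a = d}.Finite) (hw' : ∀ d, {b | w' b = d}.Finite) (A : Set α) (B : Set β) :
    weightSeries (prodWeight w w') (A ×ˢ B) = weightSeries w A * weightSeries w' B := by
  classical
  ext d
  rw [MvPowerSeries.coeff_mul, coeff_weightSeries, setOf_prodWeight_eq]
  have hfin (e : (σ →₀ ℕ) × (σ →₀ ℕ)) :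
      ({a | a ∈ A ∧ w a = e.1} ×ˢ {b | b ∈ B ∧ w' b = e.2}).Finite :=
    ((hw e.1).subset fun a ha => ha.2).prod ((hw' e.2).subset fun b hb => hb.2)
  have hU : (⋃ e ∈ Finset.HasAntidiagonal.antidiagonal d,
      {a | a ∈ A ∧ w a = e.1} ×ˢ {b | b ∈ B ∧ w' b = e.2}) =
      ((Finset.HasAntidiagonal.antidiagonal d).biUnion fun e => (hfin e).toFinset : Finset (α × β)) := by
    ext; simp
  rw [hU, Set.ncard_coe_finset, Finset.card_biUnion, Nat.cast_sum]
  · refine Finset.sum_congr rfl fun e _ => ?_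
    rw [← Set.ncard_eq_toFinset_card _ (hfin e), Set.ncard_prod, Nat.cast_mul]
    rfl
  · intro e _ e' _ hne
    rw [Function.onFun, Finset.disjoint_left]
    rintro ⟨a, b⟩ h h'
    simp only [Set.Finite.mem_toFinset, Set.mem_prod, Set.mem_ofPred_eq] at h h'
    exact hne (Prod.ext (h.1.2.symm.trans h'.1.2) (h.2.2.symm.trans h'.2.2))

end WeightSeries

theorem SkelTree.finite_degree_lt (n : ℕ) : {T : SkelTree | T.weight.degree < n}.Finite := by
  induction n with
  | zero => simp
  | succ n ih =>
    refine (((Set.finite_singleton nil).union ((ih.prod ih).image fun p => clone p.1 p.2)).union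
      ((ih.prod (ih.prod ih)).image fun p => tangle p.1 p.2.1 p.2.2)).subset ?_
    rintro (_ | ⟨a, b⟩ | ⟨a, b, d⟩) h
    · exact Or.inl (Or.inl rfl)
    · simp only [Set.mem_ofPred_eq, weight, map_add, Finsupp.degree_single] at h
      exact Or.inl (Or.inr ⟨(a, b), ⟨by simp; omega, by simp; omega⟩, rfl⟩)
    · simp only [Set.mem_ofPred_eq, weight, map_add, Finsupp.degree_single] at h
      exact Or.inr ⟨(a, b, d), ⟨by simp; omega, by simp; omega, by simp; omega⟩, rfl⟩

theorem SkelTree.finite_weight_eq (d : Fin 2 →₀ ℕ) : {T : SkelTree | T.weight = d}.Finite :=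
  (finite_degree_lt (d.degree + 1)).subset fun T hT => by
    rw [Set.mem_ofPred_eq] at hT ⊢
    rw [hT]; omega

/-- The generating function of the strict trees. -/
noncomputable def strictSeries : MvPowerSeries (Fin 2) ℚ :=
  weightSeries weight {T | T.Strict}

/-- The generating function of the strict trees with a clone root. -/
noncomputable def strictCloneSeries : MvPowerSeries (Fin 2) ℚ :=
  weightSeries weight {T | T.Strict ∧ T.IsClone}

theorem strictSeries_eq :
    strictSeries = 1 + strictCloneSeries + MvPowerSeries.X 1 * strictSeries ^ 3 := by
  have hset : {T : SkelTree | T.Strict} = ({nil} ∪ {T | T.Strict ∧ T.IsClone}) ∪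
      (fun p : SkelTree × SkelTree × SkelTree => tangle p.1 p.2.1 p.2.2) ''
        ({T | T.Strict} ×ˢ ({T | T.Strict} ×ˢ {T | T.Strict})) := by
    ext T
    cases T <;> simp [Strict, IsClone]
  have hinj : Function.Injective
      fun p : SkelTree × SkelTree × SkelTree => tangle p.1 p.2.1 p.2.2 := by
    rintro ⟨a, b, d⟩ ⟨a', b', d'⟩ h
    simpa using h
  have h3 := weightSeries_image (w := prodWeight weight (prodWeight weight weight))
    (w' := weight) hinj (Finsupp.single 1 1) (fun _ => rfl)
    ({T | T.Strict} ×ˢ ({T | T.Strict} ×ˢ {T | T.Strict}))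
  rw [weightSeries_prod finite_weight_eq (finite_prodWeight finite_weight_eq finite_weight_eq),
    weightSeries_prod finite_weight_eq finite_weight_eq] at h3
  conv_lhs => rw [strictSeries, hset]
  rw [weightSeries_union finite_weight_eq, weightSeries_union finite_weight_eq, h3,
    weightSeries_singleton (a := nil) (w := weight) rfl]
  · simp only [strictSeries, strictCloneSeries, MvPowerSeries.X]
    ring
  · rw [Set.disjoint_left]
    rintro _ rfl ⟨_, a, b, h⟩
    cases h
  · rw [Set.disjoint_left]
    rintro _ (rfl | ⟨_, a, b, rfl⟩) ⟨p, _, h⟩ <;> cases h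

theorem strictCloneSeries_mul :
    strictCloneSeries * (1 + MvPowerSeries.X 0) = MvPowerSeries.X 0 * strictSeries ^ 2 := by
  set B : Set (SkelTree × SkelTree) := {p | p.1.Strict ∧ p.2.Strict ∧ ¬(p.1 = nil ∧ p.2.IsClone)}
    with hB
  have hpair : ({T | T.Strict} ×ˢ {T | T.Strict} : Set (SkelTree × SkelTree)) =
      B ∪ ({nil} ×ˢ {T | T.Strict ∧ T.IsClone}) := by
    ext ⟨a, b⟩
    simp only [hB, Set.mem_prod, Set.mem_ofPred_eq, Set.mem_union, Set.mem_singleton_iff]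
    constructor
    · tauto
    · rintro (h | ⟨rfl, h⟩)
      exacts [⟨h.1, h.2.1⟩, ⟨trivial, h.1⟩]
  have hclone : {T : SkelTree | T.Strict ∧ T.IsClone} =
      (fun p : SkelTree × SkelTree => clone p.1 p.2) '' B := by
    ext T
    cases T <;> simp [hB, Strict, IsClone]
  have hinj : Function.Injective fun p : SkelTree × SkelTree => clone p.1 p.2 := by
    rintro ⟨a, b⟩ ⟨a', b'⟩ h
    simpa using h
  have h1 := weightSeries_image (w := prodWeight weight weight) (w' := weight) hinj
    (Finsupp.single 0 1) (fun _ => rfl) B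
  rw [← hclone] at h1
  have h2 := weightSeries_prod finite_weight_eq finite_weight_eq {T | T.Strict} {T | T.Strict}
  rw [hpair, weightSeries_union (finite_prodWeight finite_weight_eq finite_weight_eq),
    weightSeries_prod finite_weight_eq finite_weight_eq, weightSeries_singleton (a := nil) (w := weight) rfl] at h2
  · change strictCloneSeries = _ * MvPowerSeries.X 0 at h1
    change _ + 1 * strictCloneSeries = strictSeries * strictSeries at h2
    linear_combination h1 + MvPowerSeries.X 0 * h2
  · rw [Set.disjoint_left]
    rintro p ⟨_, _, hp⟩ ⟨hp1, hp2⟩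
    exact hp ⟨hp1, hp2.2⟩

/-- Each count `N(r,s)` of abstract skeleta with `r` clone sets and
`s` tangles is finite, and the generating function `S(c,t) = Σ N(r,s) c^r t^s` in
`ℚ[[c,t]]` satisfies `S = 1 + c (1+c)⁻¹ S² + t S³`. Here the two variables `c` and `t`
are `X 0` and `X 1` in `MvPowerSeries (Fin 2) ℚ`. -/
theorem skeleta_generating_function :
    (∀ r s : ℕ, (SkelSet r s).Finite) ∧
    (letI S : MvPowerSeries (Fin 2) ℚ := fun d => ((SkelSet (d 0) (d 1)).ncard : ℚ)
     S = 1 + (MvPowerSeries.X 0) * (1 + MvPowerSeries.X 0 : MvPowerSeries (Fin 2) ℚ)⁻¹ * S ^ 2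
           + (MvPowerSeries.X 1) * S ^ 3) := by
  have hS : (fun d => ((SkelSet (d 0) (d 1)).ncard : ℚ) : MvPowerSeries (Fin 2) ℚ) =
      strictSeries := by
    funext d
    rw [skelSet_eq, Set.ncard_image_of_injective _ (build_injective 0)]
    rfl
  constructor
  · intro r s
    have h := skelSet_eq (Finsupp.single 0 r + Finsupp.single 1 s)
    simp only [Finsupp.add_apply, Finsupp.single_apply] at h
    simp only [if_true, Fin.reduceEq, if_false, add_zero, zero_add] at h
    rw [h]
    exact ((finite_weight_eq _).subset fun T hT => hT.2).image _
  · have hu : (1 + MvPowerSeries.X 0 : MvPowerSeries (Fin 2) ℚ) *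
        (1 + MvPowerSeries.X 0 : MvPowerSeries (Fin 2) ℚ)⁻¹ = 1 :=
      MvPowerSeries.mul_inv_cancel _ (by simp)
    rw [hS]
    linear_combination strictSeries_eq - strictCloneSeries * hu +
      (1 + MvPowerSeries.X 0 : MvPowerSeries (Fin 2) ℚ)⁻¹ * strictCloneSeries_mul
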